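/- For any density operator ρ_{AB₁B₂}, the total uncertainty of the tripartite game satisfies the second bound S(R|AB₁)_κ + S(A|B₂)_ω ≥ S(R)_κ + S(AB₁B₂)_ρ + S(A)_ω − S(AB₁)_κ − S(B₂)_ρ. -/

import Mathlib

open scoped Kronecker Classical ComplexOrder
open Matrix

noncomputable section

/-- The rank-one projector `|v⟩⟨v|`. -/
def proj {α : Type*} (v : α → ℂ) : Matrix α α ℂ := Matrix.vecMulVec v (star v)

/-- Matrix logarithm of a Hermitian matrix, via the spectral decomposition
(junk value `0` on non-Hermitian matrices; eigenvalue `0` contributes `log 0 = 0`). -/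
def mlog {n : Type*} [Fintype n] [DecidableEq n] (ρ : Matrix n n ℂ) : Matrix n n ℂ :=
  if h : ρ.IsHermitian then
    (h.eigenvectorUnitary : Matrix n n ℂ) *
      Matrix.diagonal (fun i => (Real.log (h.eigenvalues i) : ℂ)) *
      (h.eigenvectorUnitary : Matrix n n ℂ)ᴴ
  else 0

/-- Von Neumann entropy `S(ρ) = -Tr ρ log ρ`. -/
def vN {n : Type*} [Fintype n] [DecidableEq n] (ρ : Matrix n n ℂ) : ℝ :=
  -(Matrix.trace (ρ * mlog ρ)).re

/-- Quantum relative entropy `D(ρ‖σ) = Tr ρ (log ρ - log σ)`. -/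
def relent {n : Type*} [Fintype n] [DecidableEq n] (ρ σ : Matrix n n ℂ) : ℝ :=
  (Matrix.trace (ρ * (mlog ρ - mlog σ))).re

/-- The rotation `e^{-iGr}` generated by the Hermitian operator `G` with orthonormal
eigenbasis `g` and eigenvalues `gv`. -/
def Urot {iA : Type*} [Fintype iA] (g : iA → iA → ℂ) (gv : iA → ℝ) (r : ℝ) : Matrix iA iA ℂ :=
  ∑ l, Complex.exp (-(Complex.I) * (gv l) * r) • proj (g l)

section Tripartite

variable {iR iA iB1 iB2 : Type*} [Fintype iR] [Fintype iA] [Fintype iB1] [Fintype iB2]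
  [DecidableEq iR] [DecidableEq iA] [DecidableEq iB1] [DecidableEq iB2]

/-- `e^{-iGr} ⊗ I_{B₁} ⊗ I_{B₂}`. -/
def UA3
    (g : iA → iA → ℂ) (gv : iA → ℝ) (r : ℝ) :
    Matrix ((iA × iB1) × iB2) ((iA × iB1) × iB2) ℂ :=
  (Urot g gv r ⊗ₖ (1 : Matrix iB1 iB1 ℂ)) ⊗ₖ (1 : Matrix iB2 iB2 ℂ)

/-- `κ_{RAB₁B₂} = Σ_k p_k |r_k⟩⟨r_k| ⊗ (e^{-iGr_k}⊗I) ρ (e^{iGr_k}⊗I)`. -/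
def kappa3
    (p : iR → ℝ) (rb : iR → iR → ℂ) (rv : iR → ℝ) (g : iA → iA → ℂ) (gv : iA → ℝ)
    (ρ : Matrix ((iA × iB1) × iB2) ((iA × iB1) × iB2) ℂ) :
    Matrix (iR × ((iA × iB1) × iB2)) (iR × ((iA × iB1) × iB2)) ℂ :=
  ∑ k, (p k : ℂ) • (proj (rb k) ⊗ₖ (UA3 g gv (rv k) * ρ * (UA3 g gv (rv k))ᴴ))

/-- `ω_{AB₁B₂} = Σ_l (|g_l⟩⟨g_l|⊗I) ρ (|g_l⟩⟨g_l|⊗I)`. -/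
def omega3 
    (g : iA → iA → ℂ)
    (ρ : Matrix ((iA × iB1) × iB2) ((iA × iB1) × iB2) ℂ) :
    Matrix ((iA × iB1) × iB2) ((iA × iB1) × iB2) ℂ :=
  ∑ l, ((proj (g l) ⊗ₖ (1 : Matrix iB1 iB1 ℂ)) ⊗ₖ (1 : Matrix iB2 iB2 ℂ)) * ρ *
       ((proj (g l) ⊗ₖ (1 : Matrix iB1 iB1 ℂ)) ⊗ₖ (1 : Matrix iB2 iB2 ℂ))

/-- Reduced state on `RAB₁` of a state on `RAB₁B₂`. -/
def redRAB1 
    (τ : Matrix (iR × ((iA × iB1) × iB2)) (iR × ((iA × iB1) × iB2)) ℂ) :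
    Matrix (iR × (iA × iB1)) (iR × (iA × iB1)) ℂ :=
  Matrix.of fun x y => ∑ k : iB2, τ (x.1, (x.2, k)) (y.1, (y.2, k))

/-- Reduced state on `AB₁` of a state on `RAB₁B₂`. -/
def redAB1four 
    (τ : Matrix (iR × ((iA × iB1) × iB2)) (iR × ((iA × iB1) × iB2)) ℂ) :
    Matrix (iA × iB1) (iA × iB1) ℂ :=
  Matrix.of fun x y => ∑ k : iR, ∑ m : iB2, τ (k, (x, m)) (k, (y, m))

/-- Reduced state on `R` of a state on `RAB₁B₂`. -/
def redRfour 
    (τ : Matrix (iR × ((iA × iB1) × iB2)) (iR × ((iA × iB1) × iB2)) ℂ) :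
    Matrix iR iR ℂ :=
  Matrix.of fun i j => ∑ x : (iA × iB1) × iB2, τ (i, x) (j, x)

/-- Reduced state on `AB₁` of a state on `AB₁B₂`. -/
def redAB1 
    (σ : Matrix ((iA × iB1) × iB2) ((iA × iB1) × iB2) ℂ) :
    Matrix (iA × iB1) (iA × iB1) ℂ :=
  Matrix.of fun x y => ∑ k : iB2, σ (x, k) (y, k)

/-- Reduced state on `AB₂` of a state on `AB₁B₂`. -/
def redAB2 
    (σ : Matrix ((iA × iB1) × iB2) ((iA × iB1) × iB2) ℂ) :
    Matrix (iA × iB2) (iA × iB2) ℂ :=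
  Matrix.of fun x y => ∑ m : iB1, σ ((x.1, m), x.2) ((y.1, m), y.2)

/-- Reduced state on `B₂` of a state on `AB₁B₂`. -/
def redB2 
    (σ : Matrix ((iA × iB1) × iB2) ((iA × iB1) × iB2) ℂ) :
    Matrix iB2 iB2 ℂ :=
  Matrix.of fun i j => ∑ x : iA × iB1, σ (x, i) (x, j)

/-- Reduced state on `A` of a state on `AB₁B₂`. -/
def redA3 
    (σ : Matrix ((iA × iB1) × iB2) ((iA × iB1) × iB2) ℂ) :
    Matrix iA iA ℂ :=
  Matrix.of fun i j => ∑ m : iB1, ∑ k : iB2, σ ((i, m), k) ((j, m), k)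

/-- Reduced state on `B₁` of a state on `AB₁B₂`. -/
def redB1 
    (σ : Matrix ((iA × iB1) × iB2) ((iA × iB1) × iB2) ℂ) :
    Matrix iB1 iB1 ℂ :=
  Matrix.of fun i j => ∑ a : iA, ∑ k : iB2, σ ((a, i), k) ((a, j), k)

/-- Reduced state on `B₁B₂` of a state on `AB₁B₂`. -/
def redB1B2 
    (σ : Matrix ((iA × iB1) × iB2) ((iA × iB1) × iB2) ℂ) :
    Matrix (iB1 × iB2) (iB1 × iB2) ℂ :=
  Matrix.of fun x y => ∑ a : iA, σ ((a, x.1), x.2) ((a, y.1), y.2)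

end Tripartite


lemma vN_herm {n : Type*} [Fintype n] [DecidableEq n] (ρ : Matrix n n ℂ) (h : ρ.IsHermitian) :
    vN ρ = ∑ i, Real.negMulLog (h.eigenvalues i) := by
  have hE : (h.eigenvectorUnitary : Matrix n n ℂ)ᴴ * (h.eigenvectorUnitary : Matrix n n ℂ) = 1 :=
    Unitary.coe_star_mul_self h.eigenvectorUnitary
  have hs : ρ = (h.eigenvectorUnitary : Matrix n n ℂ) * diagonal (fun i => (h.eigenvalues i : ℂ)) *
      (h.eigenvectorUnitary : Matrix n n ℂ)ᴴ := by
    conv_lhs => rw [h.spectral_theorem]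
    rfl
  unfold vN mlog
  rw [dif_pos h]
  generalize (h.eigenvectorUnitary : Matrix n n ℂ) = E at *
  generalize h.eigenvalues = l at *
  rw [hs]
  have : E * diagonal (fun i => (l i : ℂ)) * Eᴴ * (E * diagonal (fun i => (Real.log (l i) : ℂ)) * Eᴴ)
      = E * (diagonal (fun i => (l i : ℂ)) * diagonal (fun i => (Real.log (l i) : ℂ))) * Eᴴ := by
    simp only [Matrix.mul_assoc]
    rw [← Matrix.mul_assoc Eᴴ E, hE, Matrix.one_mul]
  rw [this, Matrix.trace_mul_comm, ← Matrix.mul_assoc, hE, Matrix.one_mul, diagonal_mul_diagonal,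
    trace_diagonal, Complex.re_sum, ← Finset.sum_neg_distrib]
  refine Finset.sum_congr rfl fun i _ => ?_
  rw [Real.negMulLog, ← Complex.ofReal_mul, Complex.ofReal_re]; ring

lemma vN_eq {n : Type*} [Fintype n] [DecidableEq n] (ρ U : Matrix n n ℂ) (p : n → ℝ)
    (hU : Uᴴ * U = 1) (h : ρ = U * diagonal (fun i => (p i : ℂ)) * Uᴴ) :
    vN ρ = ∑ i, Real.negMulLog (p i) := by
  have hH : ρ.IsHermitian := by
    rw [h]
    apply isHermitian_mul_mul_conjTranspose
    rw [IsHermitian, diagonal_conjTranspose]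
    congr 1; ext i; simp
  rw [vN_herm ρ hH]
  have h1 := hH.roots_charpoly_eq_eigenvalues
  have h2 : ρ.charpoly = (diagonal (fun i => (p i : ℂ))).charpoly := by
    rw [h, Matrix.charpoly_mul_comm, ← Matrix.mul_assoc, hU, Matrix.one_mul]
  have h3 : (diagonal (fun i => (p i : ℂ))).charpoly.roots
      = Multiset.map (fun i => (p i : ℂ)) Finset.univ.val := by
    rw [Matrix.charpoly_diagonal]
    have := Polynomial.roots_multiset_prod_X_sub_C (Finset.univ.val.map fun i => (p i : ℂ))
    rw [Multiset.map_map] at this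
    exact this
  rw [h2, h3] at h1
  have h4 := congrArg (fun s => (Multiset.map (fun z : ℂ => Real.negMulLog z.re) s).sum) h1
  simp only [Multiset.map_map] at h4
  simpa using h4.symm

/-- conjugating back and forth -/
lemma J_identity {n : Type*} [Fintype n] [DecidableEq n] (ρ σ U V X x : Matrix n n ℂ) (p q : n → ℝ)
    (hU : Uᴴ * U = 1) (hV : Vᴴ * V = 1)
    (hρ : ρ = U * diagonal (fun i => (p i : ℂ)) * Uᴴ)
    (hσ : σ = V * diagonal (fun i => (q i : ℂ)) * Vᴴ)
    (hX : X = V * x * Uᴴ) (t : ℝ) :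
    2 * (trace (X * ρ)).re - (trace (X * Xᴴ * σ)).re - t * (trace (Xᴴ * X * ρ)).re
      = ∑ j, ∑ i, (2 * (p i * (x j i * (Uᴴ * V) i j).re) - (q j + t * p i) * Complex.normSq (x j i)) := by
  have e1 : trace (X * ρ) = ∑ j, ∑ i, (p i : ℂ) * (x j i * (Uᴴ * V) i j) := by
    have : X * ρ = V * (x * diagonal (fun i => (p i : ℂ)) * Uᴴ) := by
      rw [hX, hρ]; simp only [Matrix.mul_assoc]; rw [← Matrix.mul_assoc Uᴴ U, hU, Matrix.one_mul]
    rw [this, trace_mul_comm, Matrix.mul_assoc]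
    simp only [trace, diag, Matrix.mul_apply (M := x * _), mul_diagonal]
    refine Finset.sum_congr rfl fun j _ => Finset.sum_congr rfl fun i _ => by ring
  have e2 : trace (X * Xᴴ * σ) = ∑ j, ∑ i, (q j : ℂ) * Complex.normSq (x j i) := by
    have : X * Xᴴ * σ = V * (x * xᴴ * diagonal (fun i => (q i : ℂ)) * Vᴴ) := by
      rw [hX, hσ]; simp only [Matrix.mul_assoc, conjTranspose_mul, conjTranspose_conjTranspose]
      rw [← Matrix.mul_assoc Uᴴ U, hU, Matrix.one_mul, ← Matrix.mul_assoc Vᴴ V, hV, Matrix.one_mul]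
    rw [this, trace_mul_comm, Matrix.mul_assoc, hV, Matrix.mul_one]
    simp only [trace, diag, mul_diagonal]
    simp only [Matrix.mul_apply, conjTranspose_apply, Finset.sum_mul]
    refine Finset.sum_congr rfl fun j _ => Finset.sum_congr rfl fun i _ => ?_
    rw [Complex.star_def, Complex.mul_conj]; ring
  have e3 : trace (Xᴴ * X * ρ) = ∑ j, ∑ i, (p i : ℂ) * Complex.normSq (x j i) := by
    have : Xᴴ * X * ρ = U * (xᴴ * x * diagonal (fun i => (p i : ℂ)) * Uᴴ) := by
      rw [hX, hρ]; simp only [Matrix.mul_assoc, conjTranspose_mul, conjTranspose_conjTranspose]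
      rw [← Matrix.mul_assoc Uᴴ U, hU, Matrix.one_mul, ← Matrix.mul_assoc Vᴴ V, hV, Matrix.one_mul]
    rw [this, trace_mul_comm, Matrix.mul_assoc, hU, Matrix.mul_one]
    simp only [trace, diag, mul_diagonal]
    simp only [Matrix.mul_apply, conjTranspose_apply, Finset.sum_mul]
    rw [Finset.sum_comm]
    refine Finset.sum_congr rfl fun j _ => Finset.sum_congr rfl fun i _ => ?_
    rw [Complex.star_def, mul_comm ((starRingEnd ℂ) _), Complex.mul_conj]; ring
  rw [e1, e2, e3]
  simp only [Complex.re_sum, Complex.re_ofReal_mul, Complex.ofReal_re, Finset.mul_sum,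
    ← Finset.sum_sub_distrib]
  refine Finset.sum_congr rfl fun j _ => Finset.sum_congr rfl fun i _ => ?_
  ring

/-- quadratic functional value -/
def Ft {n : Type*} [Fintype n] (e : Matrix n n ℂ) (p q : n → ℝ) (t : ℝ) : ℝ :=
  ∑ j, ∑ i, Complex.normSq (e i j) * (p i * (p i / (q j + t * p i)))

lemma Ft_ge {n : Type*} [Fintype n] (e x : Matrix n n ℂ) (p q : n → ℝ) (t : ℝ) (ht : 0 < t)
    (hp : ∀ i, 0 ≤ p i) (hq : ∀ i, 0 ≤ q i) :
    ∑ j, ∑ i, (2 * (p i * (x j i * e i j).re) - (q j + t * p i) * Complex.normSq (x j i))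
      ≤ Ft e p q t := by
  refine Finset.sum_le_sum fun j _ => Finset.sum_le_sum fun i _ => ?_
  have h0 : 0 ≤ q j + t * p i := add_nonneg (hq j) (mul_nonneg ht.le (hp i))
  rcases h0.eq_or_lt with h | h
  · have : p i = 0 := by
      have := hq j; have := mul_nonneg ht.le (hp i)
      have : t * p i = 0 := by linarith
      simpa [ht.ne'] using this
    rw [← h, this]; simp
  · set s := q j + t * p i
    have key : Complex.normSq (e i j) * (p i * (p i / s))
        - (2 * (p i * (x j i * e i j).re) - s * Complex.normSq (x j i))
        = ((p i * (e i j).re - s * (x j i).re)^2 + (p i * (e i j).im + s * (x j i).im)^2) / s := by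
      rw [Complex.mul_re, Complex.normSq_apply, Complex.normSq_apply]
      field_simp
      ring
    have : 0 ≤ ((p i * (e i j).re - s * (x j i).re)^2 + (p i * (e i j).im + s * (x j i).im)^2) / s := by
      positivity
    linarith

lemma Ft_eq {n : Type*} [Fintype n] (e : Matrix n n ℂ) (p q : n → ℝ) (t : ℝ) (ht : 0 < t)
    (hp : ∀ i, 0 ≤ p i) (hq : ∀ i, 0 ≤ q i) :
    ∑ j, ∑ i, (2 * (p i * (((p i / (q j + t * p i) : ℝ) : ℂ) * star (e i j) * e i j).re)
      - (q j + t * p i) * Complex.normSq (((p i / (q j + t * p i) : ℝ) : ℂ) * star (e i j)))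
      = Ft e p q t := by
  refine Finset.sum_congr rfl fun j _ => Finset.sum_congr rfl fun i _ => ?_
  have h0 : 0 ≤ q j + t * p i := add_nonneg (hq j) (mul_nonneg ht.le (hp i))
  rw [mul_assoc, mul_comm (star (e i j)), Complex.star_def, Complex.mul_conj, Complex.normSq_mul,
    Complex.normSq_conj, Complex.normSq_ofReal, Complex.re_ofReal_mul, Complex.ofReal_re]
  rcases h0.eq_or_lt with h | h
  · rw [← h]; simp
  · field_simp; ring

def ptr {n b : Type*} [Fintype b] (ρ : Matrix (n × b) (n × b) ℂ) : Matrix n n ℂ :=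
  Matrix.of fun x y => ∑ k, ρ (x, k) (y, k)

lemma trace_kron_ptr {n b : Type*} [Fintype n] [Fintype b] [DecidableEq b]
    (X : Matrix n n ℂ) (ρ : Matrix (n × b) (n × b) ℂ) :
    trace ((X ⊗ₖ (1 : Matrix b b ℂ)) * ρ) = trace (X * ptr ρ) := by
  simp only [trace, diag, Matrix.mul_apply, Fintype.sum_prod_type, kroneckerMap_apply, ptr,
    Matrix.one_apply, of_apply, Finset.mul_sum, mul_ite, mul_one, mul_zero, ite_mul, zero_mul,
    Finset.sum_ite_eq, Finset.mem_univ, if_true]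
  refine Finset.sum_congr rfl fun x _ => ?_
  rw [Finset.sum_comm]

lemma Ft_mono {n b : Type*} [Fintype n] [Fintype b] [DecidableEq b] [DecidableEq n]
    (ρ σ U V : Matrix (n × b) (n × b) ℂ) (p q : n × b → ℝ)
    (U' V' : Matrix n n ℂ) (p' q' : n → ℝ)
    (hU : Uᴴ * U = 1) (hV : Vᴴ * V = 1) (hU' : U'ᴴ * U' = 1) (hV' : V'ᴴ * V' = 1)
    (hρ : ρ = U * diagonal (fun i => (p i : ℂ)) * Uᴴ)
    (hσ : σ = V * diagonal (fun i => (q i : ℂ)) * Vᴴ)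
    (hρ' : ptr ρ = U' * diagonal (fun i => (p' i : ℂ)) * U'ᴴ)
    (hσ' : ptr σ = V' * diagonal (fun i => (q' i : ℂ)) * V'ᴴ)
    (hp : ∀ i, 0 ≤ p i) (hq : ∀ i, 0 ≤ q i) (hp' : ∀ i, 0 ≤ p' i) (hq' : ∀ i, 0 ≤ q' i)
    (t : ℝ) (ht : 0 < t) :
    Ft (U'ᴴ * V') p' q' t ≤ Ft (Uᴴ * V) p q t := by
  have hVV : V * Vᴴ = 1 := mul_eq_one_comm.mp hV
  have hUU : U * Uᴴ = 1 := mul_eq_one_comm.mp hU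
  rw [← Ft_eq (U'ᴴ * V') p' q' t ht hp' hq']
  let x' : Matrix n n ℂ := of fun j i =>
    ((p' i / (q' j + t * p' i) : ℝ) : ℂ) * star ((U'ᴴ * V') i j)
  let X' := V' * x' * U'ᴴ
  let X : Matrix (n × b) (n × b) ℂ := X' ⊗ₖ (1 : Matrix b b ℂ)
  have h1 := J_identity (ptr ρ) (ptr σ) U' V' X' x' p' q' hU' hV' hρ' hσ' rfl t
  have h2 := J_identity ρ σ U V X (Vᴴ * X * U) p q hU hV hρ hσ (by
    simp only [Matrix.mul_assoc]
    rw [hUU, Matrix.mul_one, ← Matrix.mul_assoc, hVV, Matrix.one_mul]) t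
  have hXh : Xᴴ = X'ᴴ ⊗ₖ (1 : Matrix b b ℂ) := by
    simp only [X]; rw [conjTranspose_kronecker, conjTranspose_one]
  have h3 := Ft_ge (Uᴴ * V) (Vᴴ * X * U) p q t ht hp hq
  rw [← h2, hXh] at h3
  simp only [X] at h3
  rw [← mul_kronecker_mul, ← mul_kronecker_mul, Matrix.one_mul, trace_kron_ptr, trace_kron_ptr,
    trace_kron_ptr, h1] at h3
  exact h3

/-- potential -/
def Phi {n : Type*} [Fintype n] (e : Matrix n n ℂ) (p q : n → ℝ) (t : ℝ) : ℝ :=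
  ∑ j, ∑ i, Complex.normSq (e i j) * (p i * Real.log (q j + t * p i))

lemma Phi_hasDerivAt {n : Type*} [Fintype n] (e : Matrix n n ℂ) (p q : n → ℝ) (t : ℝ) (ht : 0 < t)
    (hp : ∀ i, 0 ≤ p i) (hq : ∀ i, 0 ≤ q i) :
    HasDerivAt (Phi e p q) (Ft e p q t) t := by
  unfold Phi Ft
  refine HasDerivAt.fun_sum fun j _ => HasDerivAt.fun_sum fun i _ => ?_
  apply HasDerivAt.const_mul
  apply HasDerivAt.const_mul
  rcases (hp i).eq_or_lt with h | h
  · rw [← h]; simpa using hasDerivAt_const t (Real.log (q j))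
  · have : 0 < q j + t * p i := add_pos_of_nonneg_of_pos (hq j) (mul_pos ht h)
    have h1 : HasDerivAt (fun t => q j + t * p i) (p i) t := by
      simpa using ((hasDerivAt_id t).mul_const (p i)).const_add (q j)
    exact h1.log this.ne'

lemma Phi_cont {n : Type*} [Fintype n] (e : Matrix n n ℂ) (p q : n → ℝ)
    (hp : ∀ i, 0 ≤ p i) (hq : ∀ i, 0 ≤ q i)
    (hs : ∀ i j, q j = 0 → Complex.normSq (e i j) * p i = 0) :
    ContinuousOn (Phi e p q) (Set.Ici 0) := by
  unfold Phi
  refine continuousOn_finsetSum _ fun j _ => continuousOn_finsetSum _ fun i _ => ?_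
  rcases (hq j).eq_or_lt with h | h
  · have := hs i j h.symm
    simp only [← mul_assoc, this, zero_mul]
    exact continuousOn_const
  · apply ContinuousOn.mul continuousOn_const
    apply ContinuousOn.mul continuousOn_const
    apply ContinuousOn.log (by fun_prop)
    intro t ht
    have : 0 < q j + t * p i := add_pos_of_pos_of_nonneg h (mul_nonneg ht (hp i))
    exact this.ne'

lemma Phi_tendsto {n : Type*} [Fintype n] (e : Matrix n n ℂ) (p q : n → ℝ)
    (hp : ∀ i, 0 ≤ p i) (hq : ∀ i, 0 ≤ q i) (he : ∀ i, ∑ j, Complex.normSq (e i j) = 1) :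
    Filter.Tendsto (fun t => Phi e p q t - (∑ i, p i) * Real.log t) Filter.atTop
      (nhds (∑ i, p i * Real.log (p i))) := by
  have h1 : ∀ f : n → ℝ, ∑ j, ∑ i, Complex.normSq (e i j) * f i = ∑ i, f i := by
    intro f
    rw [Finset.sum_comm]
    refine Finset.sum_congr rfl fun i _ => ?_
    rw [← Finset.sum_mul, he, one_mul]
  rw [← h1 (fun i => p i * Real.log (p i))]
  have h2 : (fun t => Phi e p q t - (∑ i, p i) * Real.log t) = fun t => ∑ j, ∑ i,
      (Complex.normSq (e i j) * (p i * (Real.log (q j + t * p i) - Real.log t))) := by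
    funext t
    rw [Finset.sum_mul, ← h1, Phi, ← Finset.sum_sub_distrib]
    refine Finset.sum_congr rfl fun j _ => ?_
    rw [← Finset.sum_sub_distrib]
    refine Finset.sum_congr rfl fun i _ => ?_
    ring
  rw [h2]
  refine tendsto_finsetSum _ fun j _ => tendsto_finsetSum _ fun i _ => ?_
  apply Filter.Tendsto.const_mul
  rcases (hp i).eq_or_lt with h | h
  · rw [← h]; simp
  · apply Filter.Tendsto.const_mul
    have h3 : Filter.Tendsto (fun t : ℝ => Real.log (q j / t + p i)) Filter.atTop
        (nhds (Real.log (p i))) := by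
      apply Filter.Tendsto.log _ h.ne'
      have := (Filter.Tendsto.const_div_atTop (Filter.tendsto_id (α := ℝ)) (q j)).add_const (p i)
      simpa using this
    refine h3.congr' ?_
    filter_upwards [Filter.eventually_gt_atTop 0] with t ht
    have : 0 < q j + t * p i := add_pos_of_nonneg_of_pos (hq j) (mul_pos ht h)
    rw [← Real.log_div this.ne' ht.ne']
    congr 1
    field_simp

lemma diag_conj {n : Type*} [Fintype n] [DecidableEq n] (ρ U V : Matrix n n ℂ) (p : n → ℝ)
    (hρ : ρ = U * diagonal (fun i => (p i : ℂ)) * Uᴴ) (j : n) :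
    ((Vᴴ * ρ * V) j j).re = ∑ i, Complex.normSq ((Uᴴ * V) i j) * p i := by
  have : Vᴴ * ρ * V = (Uᴴ * V)ᴴ * diagonal (fun i => (p i : ℂ)) * (Uᴴ * V) := by
    rw [hρ, conjTranspose_mul, conjTranspose_conjTranspose]; simp only [Matrix.mul_assoc]
  rw [this]
  generalize Uᴴ * V = e
  rw [Matrix.mul_apply, Complex.re_sum]
  refine Finset.sum_congr rfl fun i _ => ?_
  rw [mul_diagonal, conjTranspose_apply, Complex.star_def, mul_right_comm,
    mul_comm ((starRingEnd ℂ) _), Complex.mul_conj, ← Complex.ofReal_mul, Complex.ofReal_re]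

lemma unit_row {n : Type*} [Fintype n] [DecidableEq n] (U V : Matrix n n ℂ)
    (hU : Uᴴ * U = 1) (hV : Vᴴ * V = 1) (i : n) : ∑ j, Complex.normSq ((Uᴴ * V) i j) = 1 := by
  have hVV : V * Vᴴ = 1 := mul_eq_one_comm.mp hV
  have : (Uᴴ * V) * (Uᴴ * V)ᴴ = 1 := by
    rw [conjTranspose_mul, conjTranspose_conjTranspose, Matrix.mul_assoc, ← Matrix.mul_assoc V, hVV,
      Matrix.one_mul, hU]
  have h := congrFun (congrFun this i) i
  rw [Matrix.mul_apply, one_apply_eq] at h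
  simp only [conjTranspose_apply, Complex.star_def, Complex.mul_conj] at h
  exact_mod_cast h

lemma Phi_zero {n : Type*} [Fintype n] [DecidableEq n] (ρ U V : Matrix n n ℂ) (p q : n → ℝ)
    (hρ : ρ = U * diagonal (fun i => (p i : ℂ)) * Uᴴ) :
    Phi (Uᴴ * V) p q 0 = ∑ j, ((Vᴴ * ρ * V) j j).re * Real.log (q j) := by
  unfold Phi
  refine Finset.sum_congr rfl fun j _ => ?_
  rw [diag_conj ρ U V p hρ, Finset.sum_mul]
  refine Finset.sum_congr rfl fun i _ => ?_
  simp [mul_assoc]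

lemma trace_decomp {n : Type*} [Fintype n] [DecidableEq n] (ρ U : Matrix n n ℂ) (p : n → ℝ)
    (hU : Uᴴ * U = 1)
    (hρ : ρ = U * diagonal (fun i => (p i : ℂ)) * Uᴴ) : trace ρ = ∑ i, (p i : ℂ) := by
  rw [hρ, trace_mul_comm, ← Matrix.mul_assoc, hU, Matrix.one_mul, trace_diagonal]

/-- Data processing for partial trace. -/
theorem dpi {n b : Type*} [Fintype n] [Fintype b] [DecidableEq b] [DecidableEq n]
    (ρ σ U V : Matrix (n × b) (n × b) ℂ) (p q : n × b → ℝ)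
    (U' V' : Matrix n n ℂ) (p' q' : n → ℝ)
    (hU : Uᴴ * U = 1) (hV : Vᴴ * V = 1) (hU' : U'ᴴ * U' = 1) (hV' : V'ᴴ * V' = 1)
    (hρ : ρ = U * diagonal (fun i => (p i : ℂ)) * Uᴴ)
    (hσ : σ = V * diagonal (fun i => (q i : ℂ)) * Vᴴ)
    (hρ' : ptr ρ = U' * diagonal (fun i => (p' i : ℂ)) * U'ᴴ)
    (hσ' : ptr σ = V' * diagonal (fun i => (q' i : ℂ)) * V'ᴴ)
    (hp : ∀ i, 0 ≤ p i) (hq : ∀ i, 0 ≤ q i) (hp' : ∀ i, 0 ≤ p' i) (hq' : ∀ i, 0 ≤ q' i)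
    (hs : ∀ j, q j = 0 → ((Vᴴ * ρ * V) j j).re = 0)
    (hs' : ∀ j, q' j = 0 → ((V'ᴴ * ptr ρ * V') j j).re = 0) :
    ∑ i, p' i * Real.log (p' i) - ∑ j, ((V'ᴴ * ptr ρ * V') j j).re * Real.log (q' j)
      ≤ ∑ i, p i * Real.log (p i) - ∑ j, ((Vᴴ * ρ * V) j j).re * Real.log (q j) := by
  have sup : ∀ i j, q j = 0 → Complex.normSq ((Uᴴ * V) i j) * p i = 0 := by
    intro i j h
    have h1 := hs j h
    rw [diag_conj ρ U V p hρ] at h1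
    exact (Finset.sum_eq_zero_iff_of_nonneg
      (fun i _ => mul_nonneg (Complex.normSq_nonneg _) (hp i))).mp h1 i (Finset.mem_univ _)
  have sup' : ∀ i j, q' j = 0 → Complex.normSq ((U'ᴴ * V') i j) * p' i = 0 := by
    intro i j h
    have h1 := hs' j h
    rw [diag_conj (ptr ρ) U' V' p' hρ'] at h1
    exact (Finset.sum_eq_zero_iff_of_nonneg
      (fun i _ => mul_nonneg (Complex.normSq_nonneg _) (hp' i))).mp h1 i (Finset.mem_univ _)
  have htr : ∑ i, p i = ∑ i, p' i := by
    have h1 : trace ρ = trace (ptr ρ) := by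
      have := trace_kron_ptr (1 : Matrix n n ℂ) ρ
      rwa [one_kronecker_one, Matrix.one_mul, Matrix.one_mul] at this
    rw [trace_decomp ρ U p hU hρ, trace_decomp _ U' p' hU' hρ'] at h1
    exact_mod_cast h1
  rw [← Phi_zero ρ U V p q hρ, ← Phi_zero (ptr ρ) U' V' p' q' hρ']
  have hm : MonotoneOn (fun t => Phi (Uᴴ * V) p q t - Phi (U'ᴴ * V') p' q' t) (Set.Ici 0) := by
    have hd : ∀ t ∈ interior (Set.Ici (0:ℝ)),
        HasDerivAt (fun t => Phi (Uᴴ * V) p q t - Phi (U'ᴴ * V') p' q' t)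
        (Ft (Uᴴ * V) p q t - Ft (U'ᴴ * V') p' q' t) t := by
      intro t ht
      rw [interior_Ici] at ht
      exact (Phi_hasDerivAt _ p q t ht hp hq).sub (Phi_hasDerivAt _ p' q' t ht hp' hq')
    apply monotoneOn_of_deriv_nonneg (convex_Ici 0)
    · exact (Phi_cont _ p q hp hq sup).sub (Phi_cont _ p' q' hp' hq' sup')
    · exact fun t ht => (hd t ht).differentiableAt.differentiableWithinAt
    · intro t ht
      rw [(hd t ht).deriv]
      rw [interior_Ici] at ht
      exact sub_nonneg.mpr (Ft_mono ρ σ U V p q U' V' p' q' hU hV hU' hV' hρ hσ hρ' hσ' hp hq hp' hq' t ht)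
  have hl := (Phi_tendsto (Uᴴ * V) p q hp hq (unit_row U V hU hV)).sub
    (Phi_tendsto (U'ᴴ * V') p' q' hp' hq' (unit_row U' V' hU' hV'))
  have := ge_of_tendsto (b := Phi (Uᴴ * V) p q 0 - Phi (U'ᴴ * V') p' q' 0) hl (by
    filter_upwards [Filter.eventually_ge_atTop 0] with t ht
    have := hm (Set.mem_Ici.mpr le_rfl) ht ht
    rw [htr]
    simp only at this
    linarith)
  linarith

def ctrl {α β : Type*} (G : Matrix α α ℂ) (W : α → Matrix β β ℂ) : Matrix (α × β) (α × β) ℂ :=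
  of fun x y => G x.1 y.1 * W y.1 x.2 y.2

def mix {α β : Type*} [Fintype α] (G : Matrix α α ℂ) (M : α → Matrix β β ℂ) :
    Matrix (α × β) (α × β) ℂ :=
  of fun x y => ∑ l, G x.1 l * star (G y.1 l) * M l x.2 y.2

def blk {α β : Type*} [Fintype α] (G : Matrix α α ℂ) (ρ : Matrix (α × β) (α × β) ℂ) (c : α) :
    Matrix β β ℂ :=
  of fun b b' => ∑ x, ∑ y, star (G x c) * ρ (x, b) (y, b') * G y c

section ctrlsec
variable {α β : Type*} [Fintype α] [Fintype β] [DecidableEq α] [DecidableEq β]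

lemma ctrl_unitary (G : Matrix α α ℂ) (W : α → Matrix β β ℂ) (hG : Gᴴ * G = 1)
    (hW : ∀ l, (W l)ᴴ * W l = 1) : (ctrl G W)ᴴ * ctrl G W = 1 := by
  ext ⟨l, k⟩ ⟨l', k'⟩
  have h1 : ((ctrl G W)ᴴ * ctrl G W) (l, k) (l', k') = (Gᴴ * G) l l' * ((W l)ᴴ * W l') k k' := by
    simp only [Matrix.mul_apply, conjTranspose_apply, ctrl, of_apply, Fintype.sum_prod_type,
      Finset.sum_mul_sum, star_mul']
    refine Finset.sum_congr rfl fun a _ => Finset.sum_congr rfl fun b _ => by ring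
  rw [h1, hG]
  by_cases h : l = l'
  · subst h
    rw [hW, one_apply_eq, one_mul]
    simp [one_apply]
  · simp [one_apply, h]

lemma ctrl_decomp (G : Matrix α α ℂ) (W : α → Matrix β β ℂ) (M : α → Matrix β β ℂ) (μ : α × β → ℝ)
    (hM : ∀ l, M l = W l * diagonal (fun k => (μ (l, k) : ℂ)) * (W l)ᴴ) :
    mix G M = ctrl G W * diagonal (fun i => (μ i : ℂ)) * (ctrl G W)ᴴ := by
  ext ⟨a, b⟩ ⟨a', b'⟩
  simp only [mix, of_apply, hM]
  rw [Matrix.mul_apply]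
  simp only [mul_diagonal, conjTranspose_apply, ctrl, of_apply, Fintype.sum_prod_type, star_mul']
  refine Finset.sum_congr rfl fun l _ => ?_
  rw [Matrix.mul_apply, Finset.mul_sum]
  simp only [mul_diagonal, conjTranspose_apply]
  refine Finset.sum_congr rfl fun k _ => by ring

lemma ptr_mix (G : Matrix α α ℂ) (M : α → Matrix β β ℂ) (w : α → ℝ)
    (hw : ∀ l, trace (M l) = w l) :
    ptr (mix G M) = G * diagonal (fun i => (w i : ℂ)) * Gᴴ := by
  ext a a'
  rw [Matrix.mul_apply]
  simp only [mul_diagonal, conjTranspose_apply, ptr, mix, of_apply, ← hw, trace, diag]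
  rw [Finset.sum_comm]
  refine Finset.sum_congr rfl fun l _ => ?_
  rw [← Finset.mul_sum]; ring

lemma ctrl_diag (G : Matrix α α ℂ) (W : α → Matrix β β ℂ) (ρ : Matrix (α × β) (α × β) ℂ)
    (c : α) (k : β) :
    ((ctrl G W)ᴴ * ρ * ctrl G W) (c, k) (c, k) = ((W c)ᴴ * blk G ρ c * W c) k k := by
  simp only [Matrix.mul_apply, conjTranspose_apply, ctrl, blk, of_apply, Fintype.sum_prod_type,
    star_mul', Finset.sum_mul, Finset.mul_sum]
  rw [Finset.sum_comm]
  refine Finset.sum_congr rfl fun b _ => ?_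
  have : ∀ f : α → α → β → ℂ, ∑ y, ∑ x, ∑ b, f y x b = ∑ b, ∑ x, ∑ y, f y x b := by
    intro f
    rw [Finset.sum_comm]
    rw [Finset.sum_comm (s := (Finset.univ : Finset β))]
    refine Finset.sum_congr rfl fun x _ => ?_
    rw [Finset.sum_comm]
  rw [this]
  refine Finset.sum_congr rfl fun b' _ => Finset.sum_congr rfl fun x _ =>
    Finset.sum_congr rfl fun y _ => by ring

lemma blk_trace (G : Matrix α α ℂ) (ρ : Matrix (α × β) (α × β) ℂ) (c : α) :
    (Gᴴ * ptr ρ * G) c c = trace (blk G ρ c) := by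
  simp only [Matrix.mul_apply, conjTranspose_apply, ptr, blk, of_apply, trace, diag,
    Finset.sum_mul, Finset.mul_sum]
  rw [Finset.sum_comm (s := (Finset.univ : Finset β))]
  rw [Finset.sum_comm]
  refine Finset.sum_congr rfl fun x _ => ?_
  rw [Finset.sum_comm (s := (Finset.univ : Finset β))]

lemma blk_psd (G : Matrix α α ℂ) (ρ : Matrix (α × β) (α × β) ℂ) (hρ : ρ.PosSemidef) (c : α) :
    (blk G ρ c).PosSemidef := by
  have h := (hρ.conjTranspose_mul_mul_same (G ⊗ₖ (1 : Matrix β β ℂ))).submatrix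
    (fun b : β => (c, b))
  convert h using 1
  ext b b'
  simp only [blk, of_apply, submatrix_apply, Matrix.mul_apply, conjTranspose_apply,
    Fintype.sum_prod_type, kroneckerMap_apply, one_apply, star_mul', apply_ite star, star_one,
    star_zero, mul_ite, ite_mul, mul_one, mul_zero, zero_mul, Finset.sum_ite_eq,
    Finset.sum_ite_eq', Finset.mem_univ, if_true, Finset.sum_mul]
  rw [Finset.sum_comm]

lemma ptr_psd (ρ : Matrix (α × β) (α × β) ℂ) (hρ : ρ.PosSemidef) : (ptr ρ).PosSemidef := by
  have : ptr ρ = ∑ k : β, ρ.submatrix (fun a : α => (a, k)) (fun a => (a, k)) := by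
    ext a a'
    simp [ptr, Matrix.sum_apply]
  rw [this]
  exact posSemidef_sum _ fun k _ => hρ.submatrix _

lemma ptr_conj (X : Matrix α α ℂ) (ρ : Matrix (α × β) (α × β) ℂ) :
    ptr ((X ⊗ₖ (1 : Matrix β β ℂ)) * ρ * (X ⊗ₖ (1 : Matrix β β ℂ))ᴴ) = X * ptr ρ * Xᴴ := by
  ext a a'
  simp only [ptr, of_apply, Matrix.mul_apply, conjTranspose_apply,
    Fintype.sum_prod_type, kroneckerMap_apply, one_apply, star_mul', apply_ite star, star_one,
    star_zero, mul_ite, ite_mul, mul_one, mul_zero, zero_mul, Finset.sum_ite_eq,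
    Finset.sum_ite_eq', Finset.mem_univ, if_true, Finset.sum_mul, Finset.mul_sum]
  rw [Finset.sum_comm]
  refine Finset.sum_congr rfl fun x _ => ?_
  rw [Finset.sum_comm]
end ctrlsec

lemma psd_decomp {n : Type*} [Fintype n] [DecidableEq n] (ρ : Matrix n n ℂ) (h : ρ.PosSemidef) :
    ∃ (U : Matrix n n ℂ) (p : n → ℝ), Uᴴ * U = 1 ∧ ρ = U * diagonal (fun i => (p i : ℂ)) * Uᴴ ∧
      ∀ i, 0 ≤ p i := by
  refine ⟨h.isHermitian.eigenvectorUnitary, h.isHermitian.eigenvalues,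
    Unitary.coe_star_mul_self _, ?_, h.eigenvalues_nonneg⟩
  conv_lhs => rw [h.isHermitian.spectral_theorem]
  rfl

lemma kron_unitary {α β : Type*} [Fintype α] [Fintype β] [DecidableEq α] [DecidableEq β]
    (G : Matrix α α ℂ) (hG : Gᴴ * G = 1) :
    (G ⊗ₖ (1 : Matrix β β ℂ))ᴴ * (G ⊗ₖ (1 : Matrix β β ℂ)) = 1 := by
  rw [conjTranspose_kronecker, conjTranspose_one, ← mul_kronecker_mul, hG, Matrix.one_mul,
    one_kronecker_one]

/-- The essential inequality. -/
theorem key_ineq {iA iB1 iB2 : Type*} [Fintype iA] [Fintype iB1] [Fintype iB2]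
    [DecidableEq iA] [DecidableEq iB1] [DecidableEq iB2]
    (ρ : Matrix ((iA × iB1) × iB2) ((iA × iB1) × iB2) ℂ) (hρ : ρ.PosSemidef)
    (G : Matrix iA iA ℂ) (hG : Gᴴ * G = 1) (M : iA → Matrix iB2 iB2 ℂ)
    (hM : ∀ l, M l = ∑ m, blk (G ⊗ₖ (1 : Matrix iB1 iB1 ℂ)) ρ (l, m)) :
    vN ρ + vN (ptr (mix G M)) ≤ vN (ptr ρ) + vN (mix G M) := by
  have hNp := fun c => blk_psd (G ⊗ₖ (1 : Matrix iB1 iB1 ℂ)) ρ hρ c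
  have hMp : ∀ l, (M l).PosSemidef := fun l => by
    rw [hM]; exact posSemidef_sum _ fun m _ => hNp (l, m)
  choose W q hW hMd hq using fun l => psd_decomp (M l) (hMp l)
  obtain ⟨U, p, hU, hρd, hp⟩ := psd_decomp ρ hρ
  obtain ⟨U', p', hU', hρd', hp'⟩ := psd_decomp (ptr ρ) (ptr_psd ρ hρ)
  have hG' := kron_unitary (β := iB1) G hG
  set G' := G ⊗ₖ (1 : Matrix iB1 iB1 ℂ) with hG'def
  have htr : ∀ l, trace (M l) = ((∑ k, q l k : ℝ) : ℂ) := fun l => by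
    rw [trace_decomp (M l) (W l) (q l) (hW l) (hMd l)]; push_cast; rfl
  have e1 := vN_eq ρ U p hU hρd
  have e2 := vN_eq (ptr ρ) U' p' hU' hρd'
  have e3 := vN_eq (mix G M) (ctrl G W) (fun x => q x.1 x.2) (ctrl_unitary G W hG hW)
    (ctrl_decomp G W M _ hMd)
  have e4 := vN_eq (ptr (mix G M)) G (fun l => ∑ k, q l k) hG (ptr_mix G M _ htr)
  -- diagonal sums
  have d1 : ∀ l k, ∑ m, (((W l)ᴴ * blk G' ρ (l, m) * W l) k k).re = q l k := by
    intro l k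
    have : (W l)ᴴ * M l * W l = diagonal (fun k => (q l k : ℂ)) := by
      conv_lhs => rw [hMd l]
      simp only [Matrix.mul_assoc]
      rw [hW, Matrix.mul_one, ← Matrix.mul_assoc, hW, Matrix.one_mul]
    have h2 := congrArg Complex.re (congrFun (congrFun this k) k)
    rw [hM, Matrix.mul_sum, Matrix.sum_mul, Matrix.sum_apply, Complex.re_sum, diagonal_apply_eq,
      Complex.ofReal_re] at h2
    exact h2
  have d1n : ∀ l m k, 0 ≤ (((W l)ᴴ * blk G' ρ (l, m) * W l) k k).re := by
    intro l m k
    exact (Complex.nonneg_iff.mp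
      (((hNp (l, m)).conjTranspose_mul_mul_same (W l)).diag_nonneg (i := k))).1
  have d2 : ∀ l, ∑ m, (trace (blk G' ρ (l, m))).re = ∑ k, q l k := by
    intro l
    have := congrArg Complex.re (htr l)
    rw [hM, trace_sum, Complex.re_sum, Complex.ofReal_re] at this
    exact this
  have d2n : ∀ l m, 0 ≤ (trace (blk G' ρ (l, m))).re := fun l m =>
    (Complex.nonneg_iff.mp (hNp (l, m)).trace_nonneg).1
  have main := dpi ρ (mix G' (fun c => M c.1)) U (ctrl G' (fun c => W c.1)) p
    (fun x => q x.1.1 x.2) U' G' p' (fun c => ∑ k, q c.1 k) hU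
    (ctrl_unitary G' _ hG' fun c => hW c.1) hU' hG' hρd
    (ctrl_decomp G' _ _ _ fun c => hMd c.1) hρd' (ptr_mix G' _ _ fun c => htr c.1)
    hp (fun x => hq _ _) hp' (fun c => Finset.sum_nonneg fun k _ => hq _ _)
    (by
      rintro ⟨⟨l, m⟩, k⟩ h
      rw [ctrl_diag]
      have h1 := d1 l k
      simp only at h
      rw [h] at h1
      exact (Finset.sum_eq_zero_iff_of_nonneg (fun m _ => d1n l m k)).mp h1 m (Finset.mem_univ _))
    (by
      rintro ⟨l, m⟩ h
      rw [blk_trace]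
      have h1 := d2 l
      simp only at h
      rw [h] at h1
      exact (Finset.sum_eq_zero_iff_of_nonneg (fun m _ => d2n l m)).mp h1 m (Finset.mem_univ _))
  have s1 : ∑ j, (((ctrl G' (fun c => W c.1))ᴴ * ρ * ctrl G' (fun c => W c.1)) j j).re
      * Real.log (q j.1.1 j.2) = ∑ l, ∑ k, q l k * Real.log (q l k) := by
    simp only [Fintype.sum_prod_type, ctrl_diag]
    refine Finset.sum_congr rfl fun l _ => ?_
    rw [Finset.sum_comm]
    refine Finset.sum_congr rfl fun k _ => ?_
    rw [← Finset.sum_mul, d1]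
  have s2 : ∑ j : iA × iB1, ((G'ᴴ * ptr ρ * G') j j).re * Real.log (∑ k, q j.1 k)
      = ∑ l, (∑ k, q l k) * Real.log (∑ k, q l k) := by
    simp only [Fintype.sum_prod_type, blk_trace]
    refine Finset.sum_congr rfl fun l _ => ?_
    rw [← Finset.sum_mul, d2]
  rw [s1, s2] at main
  rw [e1, e2, e3, e4]
  simp only [Fintype.sum_prod_type (f := fun x : iA × iB2 => _), Real.negMulLog, neg_mul,
    Finset.sum_neg_distrib]
  linarith

lemma basis_unitary {α : Type*} [Fintype α] [DecidableEq α] (g : α → α → ℂ)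
    (hg : ∀ l m, star (g l) ⬝ᵥ g m = if l = m then 1 else 0) :
    (of fun a l => g l a : Matrix α α ℂ)ᴴ * (of fun a l => g l a) = 1 := by
  ext l m
  rw [one_apply, ← hg l m]
  simp [Matrix.mul_apply, dotProduct]

lemma Urot_eq {α : Type*} [Fintype α] [DecidableEq α] (g : α → α → ℂ) (gv : α → ℝ) (r : ℝ) :
    Urot g gv r = (of fun a l => g l a : Matrix α α ℂ) *
      diagonal (fun l => Complex.exp (-(Complex.I) * (gv l) * r)) * (of fun a l => g l a)ᴴ := by
  ext a a'
  rw [Matrix.mul_apply]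
  simp only [Urot, Matrix.sum_apply, proj, vecMulVec, Matrix.smul_apply, mul_diagonal, of_apply,
    conjTranspose_apply, smul_eq_mul, Pi.star_apply]
  refine Finset.sum_congr rfl fun l _ => by ring

lemma Urot_unitary {α : Type*} [Fintype α] [DecidableEq α] (g : α → α → ℂ) (gv : α → ℝ) (r : ℝ)
    (hg : ∀ l m, star (g l) ⬝ᵥ g m = if l = m then 1 else 0) :
    (Urot g gv r)ᴴ * Urot g gv r = 1 := by
  have hG := basis_unitary g hg
  rw [Urot_eq]
  set G : Matrix α α ℂ := of fun a l => g l a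
  have hGG : G * Gᴴ = 1 := mul_eq_one_comm.mp hG
  simp only [conjTranspose_mul, conjTranspose_conjTranspose, Matrix.mul_assoc]
  rw [← Matrix.mul_assoc Gᴴ G, hG, Matrix.one_mul, ← Matrix.mul_assoc (_)ᴴ (diagonal _),
    diagonal_conjTranspose, diagonal_mul_diagonal]
  have : (fun i => star (fun l => Complex.exp (-(Complex.I) * (gv l) * r)) i *
      Complex.exp (-(Complex.I) * (gv i) * r)) = fun _ => 1 := by
    funext i
    rw [Pi.star_apply, Complex.star_def, ← Complex.exp_conj, ← Complex.exp_add]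
    simp
  rw [this, diagonal_one, Matrix.one_mul, hGG]

section fin
variable {iR iA iB1 iB2 : Type*} [Fintype iR] [Fintype iA] [Fintype iB1] [Fintype iB2]
    [DecidableEq iR] [DecidableEq iA] [DecidableEq iB1] [DecidableEq iB2]

lemma omega_apply (g : iA → iA → ℂ) (ρ : Matrix ((iA × iB1) × iB2) ((iA × iB1) × iB2) ℂ)
    (a a' : iA) (m m' : iB1) (b b' : iB2) :
    omega3 g ρ ((a, m), b) ((a', m'), b') = ∑ l, g l a * star (g l a') *
      ∑ x, ∑ y, star (g l x) * ρ ((x, m), b) ((y, m'), b') * g l y := by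
  simp only [omega3, Matrix.sum_apply]
  refine Finset.sum_congr rfl fun l _ => ?_
  simp only [Matrix.mul_apply, Fintype.sum_prod_type, kroneckerMap_apply, one_apply, proj,
    vecMulVec_apply, Pi.star_apply, mul_ite, ite_mul, mul_one, mul_zero, zero_mul,
    Finset.sum_ite_eq, Finset.sum_ite_eq', Finset.mem_univ, if_true, Finset.sum_mul,
    Finset.mul_sum, Finset.sum_const_zero]
  rw [Finset.sum_comm]
  refine Finset.sum_congr rfl fun x _ => Finset.sum_congr rfl fun y _ => by ring

lemma blk_apply' (g : iA → iA → ℂ) (ρ : Matrix ((iA × iB1) × iB2) ((iA × iB1) × iB2) ℂ)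
    (l : iA) (m : iB1) (b b' : iB2) :
    blk ((of fun a l => g l a : Matrix iA iA ℂ) ⊗ₖ (1 : Matrix iB1 iB1 ℂ)) ρ (l, m) b b' =
      ∑ x, ∑ y, star (g l x) * ρ ((x, m), b) ((y, m), b') * g l y := by
  simp only [blk, Fintype.sum_prod_type, kroneckerMap_apply, one_apply, of_apply, mul_ite, ite_mul,
    mul_one, mul_zero, zero_mul, apply_ite star, star_zero,
    Finset.sum_ite_eq, Finset.sum_ite_eq', Finset.mem_univ, if_true, Finset.sum_const_zero]
  refine Finset.sum_congr rfl fun x _ => ?_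
  rw [Finset.sum_comm]
  simp only [Finset.sum_ite_eq', Finset.mem_univ, if_true]

def Mom (g : iA → iA → ℂ) (ρ : Matrix ((iA × iB1) × iB2) ((iA × iB1) × iB2) ℂ) (l : iA) :
    Matrix iB2 iB2 ℂ :=
  ∑ m, blk ((of fun a l => g l a : Matrix iA iA ℂ) ⊗ₖ (1 : Matrix iB1 iB1 ℂ)) ρ (l, m)

lemma redAB2_omega (g : iA → iA → ℂ) (ρ : Matrix ((iA × iB1) × iB2) ((iA × iB1) × iB2) ℂ) :
    redAB2 (omega3 g ρ) = mix (of fun a l => g l a) (Mom g ρ) := by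
  ext ⟨a, b⟩ ⟨a', b'⟩
  simp only [redAB2, mix, of_apply, omega_apply, Mom, Matrix.sum_apply, blk_apply']
  rw [Finset.sum_comm]
  refine Finset.sum_congr rfl fun l _ => ?_
  rw [Finset.mul_sum]

lemma redA3_ptr (σ : Matrix ((iA × iB1) × iB2) ((iA × iB1) × iB2) ℂ) :
    redA3 σ = ptr (redAB2 σ) := by
  ext a a'
  simp only [redA3, ptr, redAB2, of_apply]
  rw [Finset.sum_comm]

lemma redB2_omega (g : iA → iA → ℂ) (ρ : Matrix ((iA × iB1) × iB2) ((iA × iB1) × iB2) ℂ)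
    (hg : ∀ l m, star (g l) ⬝ᵥ g m = if l = m then 1 else 0)
    (hgc : ∑ l, proj (g l) = (1 : Matrix iA iA ℂ)) :
    redB2 (omega3 g ρ) = redB2 ρ := by
  ext b b'
  simp only [redB2, of_apply, Fintype.sum_prod_type, omega_apply]
  rw [Finset.sum_comm, Finset.sum_comm (s := (Finset.univ : Finset iA))]
  refine Finset.sum_congr rfl fun m _ => ?_
  rw [Finset.sum_comm]
  have h1 : ∀ l, ∑ a, g l a * star (g l a) = 1 := by
    intro l
    have := hg l l
    rw [if_pos rfl, dotProduct] at this
    rw [← this]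
    refine Finset.sum_congr rfl fun a _ => by rw [Pi.star_apply, mul_comm]
  simp only [← Finset.sum_mul, h1, one_mul]
  rw [Finset.sum_comm]
  refine Finset.sum_congr rfl fun x _ => ?_
  rw [Finset.sum_comm]
  have h2 : ∀ y, ∑ l, star (g l x) * ρ ((x, m), b) ((y, m), b') * g l y
      = ρ ((x, m), b) ((y, m), b') * (1 : Matrix iA iA ℂ) y x := by
    intro y
    rw [← hgc, Matrix.sum_apply, Finset.mul_sum]
    refine Finset.sum_congr rfl fun l _ => ?_
    rw [proj, vecMulVec_apply, Pi.star_apply]; ring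
  simp only [h2, one_apply, mul_ite, mul_one, mul_zero, Finset.sum_ite_eq', Finset.mem_univ, if_true]

lemma redRAB1_kappa (p : iR → ℝ) (rb : iR → iR → ℂ) (rv : iR → ℝ) (g : iA → iA → ℂ) (gv : iA → ℝ)
    (ρ : Matrix ((iA × iB1) × iB2) ((iA × iB1) × iB2) ℂ) :
    redRAB1 (kappa3 p rb rv g gv ρ) = mix (of fun a l => rb l a)
      (fun k => (p k : ℂ) • ((Urot g gv (rv k) ⊗ₖ (1 : Matrix iB1 iB1 ℂ)) * ptr ρ *
        (Urot g gv (rv k) ⊗ₖ (1 : Matrix iB1 iB1 ℂ))ᴴ)) := by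
  simp only [← ptr_conj]
  ext ⟨i, y⟩ ⟨i', y'⟩
  simp only [redRAB1, kappa3, mix, of_apply, Matrix.sum_apply, Matrix.smul_apply, kroneckerMap_apply,
    smul_eq_mul, proj, vecMulVec_apply, Pi.star_apply, ptr, UA3]
  rw [Finset.sum_comm]
  refine Finset.sum_congr rfl fun k _ => ?_
  rw [Finset.mul_sum, Finset.mul_sum]
  refine Finset.sum_congr rfl fun b _ => by ring

lemma redR_kappa (p : iR → ℝ) (rb : iR → iR → ℂ) (rv : iR → ℝ) (g : iA → iA → ℂ) (gv : iA → ℝ)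
    (ρ : Matrix ((iA × iB1) × iB2) ((iA × iB1) × iB2) ℂ) (hρtr : ρ.trace = 1)
    (hg : ∀ l m, star (g l) ⬝ᵥ g m = if l = m then 1 else 0) :
    redRfour (kappa3 p rb rv g gv ρ) = (of fun a l => rb l a) * diagonal (fun i => (p i : ℂ)) *
      (of fun a l => rb l a : Matrix iR iR ℂ)ᴴ := by
  have ht : ∀ k, ∑ x, ((UA3 g gv (rv k) * ρ * (UA3 g gv (rv k))ᴴ :
      Matrix ((iA × iB1) × iB2) ((iA × iB1) × iB2) ℂ)) x x = 1 := by
    intro k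
    change trace _ = 1
    rw [trace_mul_comm, ← Matrix.mul_assoc, UA3,
      kron_unitary _ (kron_unitary _ (Urot_unitary g gv (rv k) hg)), Matrix.one_mul, hρtr]
  ext i j
  rw [Matrix.mul_apply]
  simp only [redRfour, kappa3, of_apply, Matrix.sum_apply, Matrix.smul_apply, kroneckerMap_apply,
    smul_eq_mul, proj, vecMulVec_apply, Pi.star_apply, mul_diagonal, conjTranspose_apply]
  rw [Finset.sum_comm]
  refine Finset.sum_congr rfl fun k _ => ?_
  rw [← Finset.mul_sum, ← Finset.mul_sum, ht]; ring

lemma vN_kappa (p : iR → ℝ) (rb : iR → iR → ℂ) (rv : iR → ℝ) (g : iA → iA → ℂ) (gv : iA → ℝ)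
    (ρ : Matrix ((iA × iB1) × iB2) ((iA × iB1) × iB2) ℂ) (hρ : ρ.PosSemidef) (hρtr : ρ.trace = 1)
    (hg : ∀ l m, star (g l) ⬝ᵥ g m = if l = m then 1 else 0)
    (hrb : ∀ k m, star (rb k) ⬝ᵥ rb m = if k = m then 1 else 0) (hps : ∑ k, p k = 1) :
    vN (redRAB1 (kappa3 p rb rv g gv ρ)) = vN (redRfour (kappa3 p rb rv g gv ρ)) + vN (ptr ρ) := by
  have hR := basis_unitary rb hrb
  obtain ⟨W, q, hW, hd, hq⟩ := psd_decomp (ptr ρ) (ptr_psd ρ hρ)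
  have hX := fun k => kron_unitary (β := iB1) _ (Urot_unitary g gv (rv k) hg)
  have hq1 : ∑ i, q i = 1 := by
    have h1 : trace ρ = trace (ptr ρ) := by
      have := trace_kron_ptr (1 : Matrix (iA × iB1) (iA × iB1) ℂ) ρ
      rwa [one_kronecker_one, Matrix.one_mul, Matrix.one_mul] at this
    rw [hρtr, trace_decomp _ W q hW hd] at h1
    exact_mod_cast h1.symm
  rw [vN_eq _ _ p hR (redR_kappa p rb rv g gv ρ hρtr hg), vN_eq _ W q hW hd, redRAB1_kappa]
  rw [vN_eq _ _ (fun x => p x.1 * q x.2)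
    (ctrl_unitary (of fun a l => rb l a)
      (fun k => (Urot g gv (rv k) ⊗ₖ (1 : Matrix iB1 iB1 ℂ)) * W) hR (fun k => by
        rw [conjTranspose_mul, Matrix.mul_assoc, ← Matrix.mul_assoc (_ ⊗ₖ _)ᴴ, hX, Matrix.one_mul, hW]))
    (ctrl_decomp _ _ _ _ (fun k => by
      have : diagonal (fun x => ((p k * q x : ℝ) : ℂ)) = (p k : ℂ) • diagonal (fun x => (q x : ℂ)) := by
        rw [← diagonal_smul]; congr 1; funext x; simp
      simp only
      rw [this, hd, conjTranspose_mul]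
      simp only [Matrix.mul_assoc, Matrix.mul_smul, Matrix.smul_mul]))]
  simp only [Fintype.sum_prod_type, Real.negMulLog_mul, Finset.sum_add_distrib, ← Finset.mul_sum,
    ← Finset.sum_mul, hq1, hps, one_mul]
end fin

/-- **The second bound for the tripartite game** (Eq. (eqsecrel)):
`S(R|AB₁)_κ + S(A|B₂)_ω ≥ S(R)_κ + S(AB₁B₂)_ρ + S(A)_ω − S(AB₁)_κ − S(B₂)_ρ`. -/
theorem tripartite_second_bound
    {iR iA iB1 iB2 : Type*} [Fintype iR] [Fintype iA] [Fintype iB1] [Fintype iB2]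
    [DecidableEq iR] [DecidableEq iA] [DecidableEq iB1] [DecidableEq iB2]
    (ρ : Matrix ((iA × iB1) × iB2) ((iA × iB1) × iB2) ℂ)
    (hρ : ρ.PosSemidef) (hρtr : ρ.trace = 1)
    (g : iA → iA → ℂ) (gv : iA → ℝ)
    (hg : ∀ l m, star (g l) ⬝ᵥ g m = if l = m then 1 else 0)
    (hgc : ∑ l, proj (g l) = (1 : Matrix iA iA ℂ))
    (rb : iR → iR → ℂ)
    (hrb : ∀ k m, star (rb k) ⬝ᵥ rb m = if k = m then 1 else 0)
    (hrbc : ∑ k, proj (rb k) = (1 : Matrix iR iR ℂ))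
    (rv : iR → ℝ) (p : iR → ℝ) (hp : ∀ k, 0 ≤ p k) (hps : ∑ k, p k = 1) :
    (vN (redRAB1 (kappa3 p rb rv g gv ρ)) - vN (redAB1four (kappa3 p rb rv g gv ρ)))
      + (vN (redAB2 (omega3 g ρ)) - vN (redB2 (omega3 g ρ)))
    ≥ vN (redRfour (kappa3 p rb rv g gv ρ))
      + vN ρ + vN (redA3 (omega3 g ρ))
      - vN (redAB1four (kappa3 p rb rv g gv ρ)) - vN (redB2 ρ) := by

  have h1 := vN_kappa p rb rv g gv ρ hρ hρtr hg hrb hps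
  have h2 := key_ineq ρ hρ _ (basis_unitary g hg) (Mom g ρ) (fun l => rfl)
  rw [redA3_ptr, redB2_omega g ρ hg hgc, redAB2_omega, h1]
  linarith
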